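/- Let n, D be natural numbers and d > 1 a natural number. Then there exist X, Y ∈ ℝ^{n×d} with dist(X,Y) = 1, chosen independently of A, such that for every matrix A ∈ ℝ^{d×D}, ‖β_A(X) − β_A(Y)‖_F ≤ ((2 + 1/n)^{1/2}·π / n^{1/2}) · (σ_1(A)² + σ_2(A)²)^{1/2} · dist(X,Y). -/

import Mathlib

open Matrix MeasureTheory

/-- `sortVec v` rearranges the entries of `v` in non-decreasing order. -/
noncomputable def sortVec {n : ℕ} (v : Fin n → ℝ) : Fin n → ℝ := v ∘ Tuple.sort v

/-- The sorting-based embedding `β_A`: the `k`-th column of `β_A X` is `sort (X a_k)`,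
where `a_k` is the `k`-th column of `A`. -/
noncomputable def betaEmb {n d D : ℕ} (A : Matrix (Fin d) (Fin D) ℝ)
    (X : Matrix (Fin n) (Fin d) ℝ) : Matrix (Fin n) (Fin D) ℝ :=
  Matrix.of fun i k => sortVec (X.mulVec fun l => A l k) i

/-- Frobenius norm of a real matrix. -/
noncomputable def frob {n m : ℕ} (M : Matrix (Fin n) (Fin m) ℝ) : ℝ :=
  Real.sqrt (∑ i, ∑ j, (M i j) ^ 2)

/-- `dist(X,Y) = min_{σ ∈ S_n} ‖X - σY‖_F`, where `σ` acts by permuting rows. -/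
noncomputable def permDist {n d : ℕ} (X Y : Matrix (Fin n) (Fin d) ℝ) : ℝ :=
  ⨅ σ : Equiv.Perm (Fin n), frob (X - Y.submatrix σ id)

/-- `singularValue M k` is the `k`-th largest singular value of `M` (1-based), i.e. the
square root of the `k`-th largest eigenvalue of `M * Mᴴ`; it is `0` when `k - 1 ≥ d`. -/
noncomputable def singularValue {d D : ℕ} (M : Matrix (Fin d) (Fin D) ℝ) (k : ℕ) : ℝ :=
  if h : k - 1 < d then
    Real.sqrt (-(sortVec
      (fun i => -((Matrix.isHermitian_mul_conjTranspose_self M).eigenvalues i)) ⟨k - 1, h⟩))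
  else 0

/-- Sorting minimizes the sum of squared differences over all matchings. -/
lemma sum_sq_sortVec_sub_le {n : ℕ} (x y : Fin n → ℝ) (c : Equiv.Perm (Fin n)) :
    ∑ i, (sortVec x i - sortVec y i) ^ 2 ≤ ∑ i, (x (c i) - y i) ^ 2 := by
  have hx : ∑ i, (sortVec x i) ^ 2 = ∑ i, (x (c i)) ^ 2 := by
    rw [Equiv.sum_comp c fun i => x i ^ 2]
    exact Equiv.sum_comp (Tuple.sort x) fun i => x i ^ 2
  have hy : ∑ i, (sortVec y i) ^ 2 = ∑ i, (y i) ^ 2 :=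
    Equiv.sum_comp (Tuple.sort y) fun i => y i ^ 2
  have hmono : Monovary (sortVec x) (sortVec y) :=
    (Tuple.monotone_sort x).monovary (Tuple.monotone_sort y)
  have hxy : ∑ i, x (c i) * y i ≤ ∑ i, sortVec x i * sortVec y i := by
    have h := hmono.sum_comp_perm_mul_le_sum_mul
      (σ := (Tuple.sort y).trans (c.trans (Tuple.sort x).symm))
    refine le_trans (le_of_eq ?_) h
    rw [← Equiv.sum_comp (Tuple.sort y)]
    simp [sortVec]
  simp only [sub_sq, Finset.sum_add_distrib, Finset.sum_sub_distrib, hx, hy, mul_assoc,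
    ← Finset.mul_sum]
  linarith

/-- A sequence with `f n = -f 0` changes sign between two consecutive indices below `n`. -/
lemma exists_mul_succ_nonpos {n : ℕ} {f : ℕ → ℝ} (hf : f n = -f 0) (hn : n ≠ 0) :
    ∃ j < n, f j * f (j + 1) ≤ 0 := by
  by_contra! h
  have h0 : f 0 ≠ 0 := fun h0 => by simpa [h0] using h 0 (Nat.pos_of_ne_zero hn)
  have key : ∀ j ≤ n, 0 < f 0 * f j := by
    intro j
    induction j with
    | zero => exact fun _ => mul_self_pos.mpr h0
    | succ k ih =>
      intro hk
      have h1 := mul_pos (ih (by omega)) (h k (by omega))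
      have h2 : f 0 * f k * (f k * f (k + 1)) = f k ^ 2 * (f 0 * f (k + 1)) := by ring
      exact pos_of_mul_pos_right (h2 ▸ h1) (sq_nonneg _)
  have := key n le_rfl
  rw [hf] at this
  nlinarith [sq_nonneg (f 0)]

lemma sq_linear_cos_sin_sub_le (a b s h : ℝ) :
    ((a * Real.cos (s + h) + b * Real.sin (s + h)) - (a * Real.cos s + b * Real.sin s)) ^ 2 ≤
      (a ^ 2 + b ^ 2) * h ^ 2 := by
  set u := Real.cos (s + h) - Real.cos s
  set v := Real.sin (s + h) - Real.sin s
  have huv : u ^ 2 + v ^ 2 = 2 - 2 * Real.cos h := by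
    have hcos : Real.cos h =
        Real.cos (s + h) * Real.cos s + Real.sin (s + h) * Real.sin s := by
      rw [← Real.cos_sub]; ring_nf
    rw [hcos]
    simp only [u, v]
    linear_combination Real.sin_sq_add_cos_sq (s + h) + Real.sin_sq_add_cos_sq s
  have hle : u ^ 2 + v ^ 2 ≤ h ^ 2 := by
    linarith [Real.one_sub_sq_div_two_le_cos (x := h)]
  calc _ = (a * u + b * v) ^ 2 := by simp only [u, v]; ring
    _ ≤ (a ^ 2 + b ^ 2) * (u ^ 2 + v ^ 2) := by nlinarith [sq_nonneg (a * v - b * u)]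
    _ ≤ _ := by gcongr

/-- Replacing the first of `n` points equally spaced on a half circle by the centre changes the
sorted projections by at most `π / √n` times the length of the projection vector. -/
lemma sum_sq_sortVec_halfCircle_le {m : ℕ} (a b : ℝ) (x y : Fin (m + 1) → ℝ)
    (hy : ∀ i : Fin (m + 1), y i = a * Real.cos (Real.pi / (m + 1 : ℕ) * (i : ℕ)) +
      b * Real.sin (Real.pi / (m + 1 : ℕ) * (i : ℕ)))
    (hx0 : x 0 = 0) (hx : ∀ i, i ≠ 0 → x i = y i) :
    ∑ i, (sortVec x i - sortVec y i) ^ 2 ≤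
      Real.pi ^ 2 / (m + 1 : ℕ) * (a ^ 2 + b ^ 2) := by
  set h : ℝ := Real.pi / (m + 1 : ℕ) with hh
  set f : ℕ → ℝ := fun k => a * Real.cos (h * k) + b * Real.sin (h * k) with hf
  have hstep : ∀ k, (f (k + 1) - f k) ^ 2 ≤ (a ^ 2 + b ^ 2) * h ^ 2 := by
    intro k
    have := sq_linear_cos_sin_sub_le a b (h * k) h
    simpa [hf, mul_add] using this
  have hend : f (m + 1) = -f 0 := by
    have hpi : h * (m + 1 : ℕ) = Real.pi := by rw [hh]; field_simp
    simp only [hf, hpi]; simp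
  obtain ⟨j, hj, hsign⟩ := exists_mul_succ_nonpos hend (by omega)
  have hfj : f j ^ 2 ≤ (a ^ 2 + b ^ 2) * h ^ 2 := by
    nlinarith [hstep j, sq_nonneg (f (j + 1))]
  have hterm : ∀ i : Fin (m + 1),
      (x (Fin.cycleRange ⟨j, hj⟩ i) - y i) ^ 2 ≤ (a ^ 2 + b ^ 2) * h ^ 2 := by
    intro i
    rcases lt_trichotomy i ⟨j, hj⟩ with hi | hi | hi
    · have hval := Fin.coe_cycleRange_of_lt hi
      rw [hx _ (by intro h0; rw [h0] at hval; simp at hval), hy, hy, hval]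
      exact hstep i
    · rw [hi, Fin.cycleRange_self, hx0, hy, zero_sub, neg_sq]
      exact hfj
    · rw [Fin.cycleRange_of_gt hi, hx i (by rintro rfl; simp at hi)]
      simp; positivity
  refine (sum_sq_sortVec_sub_le x y (Fin.cycleRange ⟨j, hj⟩)).trans ?_
  refine (Finset.sum_le_sum fun i _ => hterm i).trans (le_of_eq ?_)
  simp only [Finset.sum_const, Finset.card_univ, Fintype.card_fin, nsmul_eq_mul, hh]
  field_simp

lemma sortVec_zero_le {n : ℕ} (v : Fin (n + 1) → ℝ) (i : Fin (n + 1)) : sortVec v 0 ≤ v i := by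
  have := Tuple.monotone_sort v (Fin.zero_le ((Tuple.sort v).symm i))
  simpa [sortVec] using this

/-- A diagonal entry of a Hermitian matrix is at most any upper bound of its eigenvalues. -/
lemma Matrix.IsHermitian.diag_le_of_eigenvalues_le {d : ℕ} {M : Matrix (Fin d) (Fin d) ℝ}
    (hM : M.IsHermitian) {c : ℝ} (hc : ∀ i, hM.eigenvalues i ≤ c) (l : Fin d) : M l l ≤ c := by
  set U : Matrix (Fin d) (Fin d) ℝ := hM.eigenvectorUnitary.1
  have hU : U * star U = 1 := Unitary.coe_mul_star_self hM.eigenvectorUnitary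
  have hrow : ∑ i, U l i * U l i = 1 := by
    have := congrFun (congrFun hU l) l
    simpa [Matrix.mul_apply, Matrix.star_apply] using this
  have hdiag : M l l = ∑ i, hM.eigenvalues i * (U l i * U l i) := by
    have h := congrFun (congrFun hM.spectral_theorem l) l
    rw [Unitary.conjStarAlgAut_apply, Matrix.mul_apply] at h
    rw [h]
    refine Finset.sum_congr rfl fun i _ => ?_
    simp only [Matrix.mul_diagonal, Matrix.star_apply, U]
    simp
    ring
  rw [hdiag]
  calc _ ≤ ∑ i, c * (U l i * U l i) :=
        Finset.sum_le_sum fun i _ => mul_le_mul_of_nonneg_right (hc i) (mul_self_nonneg _)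
    _ = c := by rw [← Finset.mul_sum, hrow, mul_one]

/-- The norm of a row is at most the largest singular value. -/
lemma sum_sq_row_le_singularValue_one_sq {d D : ℕ} (A : Matrix (Fin d) (Fin D) ℝ) (l : Fin d) :
    ∑ k, A l k ^ 2 ≤ singularValue A 1 ^ 2 := by
  obtain _ | d := d
  · exact l.elim0
  set hM := Matrix.isHermitian_mul_conjTranspose_self A
  set c := -(sortVec (fun i => -(hM.eigenvalues i)) 0)
  have hc : ∀ i, hM.eigenvalues i ≤ c := fun i => by
    have := sortVec_zero_le (fun i => -(hM.eigenvalues i)) i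
    simp only [c]; linarith
  have hle := hM.diag_le_of_eigenvalues_le hc l
  have hrow : (A * Aᴴ) l l = ∑ k, A l k ^ 2 := by
    simp [Matrix.mul_apply, sq]
  rw [hrow] at hle
  have hs : singularValue A 1 = Real.sqrt c := by
    simp only [singularValue, c]
    rw [dif_pos (by omega)]
    rfl
  rw [hs, Real.sq_sqrt ((Finset.sum_nonneg fun k _ => sq_nonneg (A l k)).trans hle)]
  exact hle

lemma permDist_eq_of_frob_sub_eq {n d : ℕ} {X Y : Matrix (Fin n) (Fin d) ℝ} {r : ℝ}
    (h : frob (X - Y) = r) (hle : ∀ σ : Equiv.Perm (Fin n), r ≤ frob (X - Y.submatrix σ id)) :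
    permDist X Y = r := by
  refine le_antisymm ?_ (le_ciInf hle)
  refine (ciInf_le (Set.finite_range _).bddBelow 1).trans (le_of_eq ?_)
  simpa using h

/-- For `d > 1` there exist `X, Y` with `dist(X,Y) = 1`, chosen independently of `A`,
such that for every `A ∈ ℝ^{d×D}`,
`‖β_A(X) - β_A(Y)‖_F ≤ ((2+1/n)^{1/2}·π/n^{1/2})·(σ_1(A)² + σ_2(A)²)^{1/2}·dist(X,Y)`. -/
theorem stmt14 (n D d : ℕ) (hn : 1 ≤ n) (hd : 1 < d) :
    ∃ X Y : Matrix (Fin n) (Fin d) ℝ, permDist X Y = 1 ∧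
      ∀ A : Matrix (Fin d) (Fin D) ℝ,
        frob (betaEmb A X - betaEmb A Y) ≤
          Real.sqrt (2 + 1 / (n : ℝ)) * Real.pi / Real.sqrt n *
            Real.sqrt (singularValue A 1 ^ 2 + singularValue A 2 ^ 2) * permDist X Y := by
  obtain ⟨m, rfl⟩ : ∃ m, n = m + 1 := ⟨n - 1, by omega⟩
  obtain ⟨e, rfl⟩ : ∃ e, d = e + 2 := ⟨d - 2, by omega⟩
  let Y : Matrix (Fin (m + 1)) (Fin (e + 2)) ℝ := Matrix.of fun i =>
    Fin.cons (Real.cos (Real.pi / (m + 1 : ℕ) * (i : ℕ)))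
      (Fin.cons (Real.sin (Real.pi / (m + 1 : ℕ) * (i : ℕ))) 0)
  let X : Matrix (Fin (m + 1)) (Fin (e + 2)) ℝ := Matrix.of fun i => if i = 0 then 0 else Y i
  have hYrow : ∀ i, ∑ l, Y i l ^ 2 = 1 := fun i => by simp [Y, Fin.sum_univ_succ]
  have hX0 : X 0 = 0 := by ext; simp [X]
  have hX : ∀ i, i ≠ 0 → X i = Y i := fun i hi => by ext; simp [X, hi]
  have hdist : permDist X Y = 1 := by
    refine permDist_eq_of_frob_sub_eq ?_ fun σ => ?_
    · rw [frob, Real.sqrt_eq_one, Finset.sum_eq_single 0]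
      · simpa [hX0] using hYrow 0
      · intro i _ hi
        simp [hX i hi]
      · simp
    · rw [frob, Real.one_le_sqrt, ← hYrow (σ 0)]
      refine le_trans (le_of_eq ?_) (Finset.single_le_sum
        (f := fun i => ∑ j, (X - Y.submatrix σ id) i j ^ 2)
        (fun i _ => Finset.sum_nonneg fun j _ => sq_nonneg _) (Finset.mem_univ 0))
      simp [hX0]
  refine ⟨X, Y, hdist, fun A => ?_⟩
  rw [hdist, mul_one]
  have hcol : ∀ k, ∑ i, (betaEmb A X - betaEmb A Y) i k ^ 2 ≤
      Real.pi ^ 2 / (m + 1 : ℕ) * (A 0 k ^ 2 + A 1 k ^ 2) := by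
    intro k
    refine sum_sq_sortVec_halfCircle_le (A 0 k) (A 1 k) (X.mulVec fun l => A l k)
      (Y.mulVec fun l => A l k) (fun i => ?_) ?_ fun i hi => ?_
    · simp [Y, Matrix.mulVec, dotProduct, Fin.sum_univ_succ]
      ring
    · simp [Matrix.mulVec, hX0]
    · simp [Matrix.mulVec, hX i hi]
  set S := singularValue A 1 ^ 2 + singularValue A 2 ^ 2
  have hS : ∑ k, (A 0 k ^ 2 + A 1 k ^ 2) ≤ (2 + 1 / ((m + 1 : ℕ) : ℝ)) * S := by
    rw [Finset.sum_add_distrib]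
    have h0 := sum_sq_row_le_singularValue_one_sq A 0
    have h1 := sum_sq_row_le_singularValue_one_sq A 1
    have h2 : singularValue A 1 ^ 2 ≤ S := le_add_of_nonneg_right (sq_nonneg _)
    have h3 : 0 ≤ 1 / ((m + 1 : ℕ) : ℝ) * S := by positivity
    linarith
  rw [frob]
  refine Real.sqrt_le_iff.mpr ⟨by positivity, ?_⟩
  rw [Finset.sum_comm, mul_pow, div_pow, mul_pow, Real.sq_sqrt (by positivity),
    Real.sq_sqrt (by positivity), Real.sq_sqrt (by positivity)]
  calc _ ≤ ∑ k, Real.pi ^ 2 / (m + 1 : ℕ) * (A 0 k ^ 2 + A 1 k ^ 2) :=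
        Finset.sum_le_sum fun k _ => hcol k
    _ ≤ Real.pi ^ 2 / (m + 1 : ℕ) * ((2 + 1 / ((m + 1 : ℕ) : ℝ)) * S) := by
        rw [← Finset.mul_sum]; gcongr
    _ = _ := by ring
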